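/- arXiv:1401.3325 — 3 statements merged into one kernel-verified Lean document; each statement's English description precedes it below -/
import Mathlib

section
/- Let P be a topological space (a space of parameters/games), let I be a countable nonempty set (of players), and for each i ∈ I let S_i be a nonempty compact topological space (of strategies of player i); let S = Π_{i∈I} S_i carry the product topology. For each i ∈ I let U_i be an open subset of P × S × S (the preference of player i, uniformly in the game: (p,σ,τ) ∈ U_i means that in game p player i strictly prefers τ to σ). Call σ ∈ S a Nash equilibrium of p ∈ P if for every i ∈ I and every s ∈ S_i we have (p, σ, σ[i ↦ s]) ∉ U_i, where σ[i ↦ s] is σ with its i-th component replaced by s. If D ⊆ P is dense and every p ∈ D admits a Nash equilibrium, then every p ∈ P admits a Nash equilibrium. -/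
/-- transfer of existence of Nash equilibria from a dense subclass of games
to all games, for compact strategy spaces and open preferences. -/
theorem stmt0 {P : Type*} [TopologicalSpace P]
    {I : Type*} [Countable I] [Nonempty I] [DecidableEq I]
    {S : I → Type*} [∀ i, TopologicalSpace (S i)] [∀ i, Nonempty (S i)]
    [∀ i, CompactSpace (S i)]
    (U : I → Set (P × (∀ i, S i) × (∀ i, S i)))
    (hU : ∀ i, IsOpen (U i))
    (D : Set P) (hD : Dense D)
    (hDNE : ∀ p ∈ D, ∃ σ : ∀ i, S i, ∀ (i : I) (s : S i),
      (p, σ, Function.update σ i s) ∉ U i) :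
    ∀ p : P, ∃ σ : ∀ i, S i, ∀ (i : I) (s : S i),
      (p, σ, Function.update σ i s) ∉ U i := by
  have hclosed : IsClosed {x : P × (∀ i, S i) |
      ∀ (i : I) (s : S i), (x.1, x.2, Function.update x.2 i s) ∉ U i} := by
    simp only [Set.ofPred_forall]
    refine isClosed_iInter fun i => isClosed_iInter fun s => ?_
    exact (hU i).isClosed_compl.preimage
      (continuous_fst.prodMk (continuous_snd.prodMk (continuous_snd.update i continuous_const)))
  have himage := isClosedMap_fst_of_compactSpace _ hclosed
  intro p
  have hsub : closure D ⊆ _ := himage.closure_subset_iff.2 fun q hq =>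
    let ⟨σ, hσ⟩ := hDNE q hq
    ⟨(q, σ), hσ, rfl⟩
  obtain ⟨⟨_, σ⟩, hσ, rfl⟩ := hsub (hD p)
  exact ⟨σ, hσ⟩
end

section
/- Let ⟨A, C, d, (f_a)_{a∈A}⟩ be an infinite sequential game with real-valued payoffs where C is finite and nonempty, and suppose there exists k ∈ ℕ such that for every player a and all p, q ∈ C^ω agreeing on their first k coordinates, f_a(p) = f_a(q) (the payoffs are fully determined after finitely many moves). Then the game has a subgame perfect equilibrium: a strategy profile σ such that for every γ ∈ C*, every player a, and every a-deviation σ' of σ, f_a(p^γ(σ')) ≤ f_a(p^γ(σ)). -/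
namespace SeqGame

variable {A C O : Type*}

/-- The length-`n` prefix of an infinite sequence, as a list. -/
def pre (p : ℕ → C) (n : ℕ) : List C := List.ofFn (fun i : Fin n => p i)

/-- The length-`n` history of the play induced by the strategy profile `σ` starting at `γ`. -/
def hist (σ : List C → C) (γ : List C) : ℕ → List C
  | 0 => []
  | n + 1 => hist σ γ n ++
      [if h : n < γ.length then γ.get ⟨n, h⟩ else σ (hist σ γ n)]

/-- The play `p^γ(σ)` induced by the strategy profile `σ` starting at `γ`. -/
def play (σ : List C → C) (γ : List C) (n : ℕ) : C :=
  if h : n < γ.length then γ.get ⟨n, h⟩ else σ (hist σ γ n)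

/-- `σ'` is an `a`-deviation of the strategy profile `σ`. -/
def Dev (d : List C → A) (a : A) (σ σ' : List C → C) : Prop :=
  ∀ h : List C, d h ≠ a → σ' h = σ h

end SeqGame

namespace SeqGame

variable {A C : Type*}

theorem hist_succ (σ : List C → C) (γ : List C) (n : ℕ) :
    hist σ γ (n + 1) = hist σ γ n ++ [play σ γ n] := rfl

theorem length_hist (σ : List C → C) (γ : List C) (n : ℕ) : (hist σ γ n).length = n := by
  induction n with
  | zero => rfl
  | succ n ih => simp [hist_succ, ih]

theorem hist_eq_take (σ : List C → C) (γ : List C) {n : ℕ} (hn : n ≤ γ.length) :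
    hist σ γ n = γ.take n := by
  induction n with
  | zero => simp [hist]
  | succ n ih =>
    rw [hist_succ, ih (by omega), play, dif_pos (show n < γ.length by omega)]
    simp

theorem hist_length (σ : List C → C) (γ : List C) : hist σ γ γ.length = γ := by
  simp [hist_eq_take σ γ le_rfl]

theorem play_of_le (σ : List C → C) (γ : List C) {n : ℕ} (hn : γ.length ≤ n) :
    play σ γ n = σ (hist σ γ n) := by
  rw [play, dif_neg (by omega)]

theorem getD_hist (σ : List C → C) (γ : List C) (c₀ : C) {n i : ℕ} (hi : i < n) :
    (hist σ γ n).getD i c₀ = play σ γ i := by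
  induction n with
  | zero => omega
  | succ n ih =>
    rw [hist_succ]
    rcases Nat.lt_succ_iff_lt_or_eq.mp hi with h | rfl
    · rw [List.getD_append _ _ _ _ (by rwa [length_hist]), ih h]
    · rw [List.getD_append_right _ _ _ _ (by rw [length_hist])]
      simp [length_hist]

/-- The play that follows `h`, then makes `m` moves with the backward induction rule `best`
(whose first argument is the number of moves remaining after the current one), then repeats
`c₀`. -/
def outcome (c₀ : C) (best : ℕ → List C → C) : ℕ → List C → ℕ → C
  | 0, h => fun i => h.getD i c₀
  | m + 1, h => outcome c₀ best m (h ++ [best m h])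

/-- The backward induction rule: with `m` moves remaining after the current one, the player to
move at `h` chooses a move whose resulting outcome is optimal for them. -/
theorem exists_backward_induction_rule [Finite C] (c₀ : C) (d : List C → A)
    (f : A → (ℕ → C) → ℝ) :
    ∃ best : ℕ → List C → C, ∀ m h c,
      f (d h) (outcome c₀ best m (h ++ [c])) ≤
        f (d h) (outcome c₀ best m (h ++ [best m h])) := by
  have : Nonempty C := ⟨c₀⟩
  choose opt hopt using fun (a : A) (g : C → ℕ → C) => Finite.exists_max fun c => f a (g c)
  let out : ℕ → List C → ℕ → C := fun m => Nat.rec (fun h i => h.getD i c₀)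
    (fun _ o h => o (h ++ [opt (d h) fun c => o (h ++ [c])])) m
  let best : ℕ → List C → C := fun m h => opt (d h) fun c => out m (h ++ [c])
  have hout : ∀ m h, outcome c₀ best m h = out m h := by
    intro m
    induction m with
    | zero => intro h; rfl
    | succ m ih => intro h; exact ih _
  refine ⟨best, fun m h c => ?_⟩
  simp only [hout]
  exact hopt (d h) (fun c => out m (h ++ [c])) c

/-- If every position has a value `v` for every player which the profile `σ` preserves and which
no player can increase by moving, then deviating from `σ` does not increase values along a
play. -/
theorem value_hist_le {d : List C → A} {v : A → List C → ℝ} {σ σ' : List C → C} {a : A}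
    (hσ : ∀ h, v a (h ++ [σ h]) = v a h) (hv : ∀ h c, v (d h) (h ++ [c]) ≤ v (d h) h)
    (hdev : Dev d a σ σ') (γ : List C) {n : ℕ} (hn : γ.length ≤ n) :
    v a (hist σ' γ n) ≤ v a γ := by
  induction n, hn using Nat.le_induction with
  | base => rw [hist_length]
  | succ n hn ih =>
    rw [hist_succ, play_of_le σ' γ hn]
    refine le_trans ?_ ih
    by_cases had : d (hist σ' γ n) = a
    · simpa only [had] using hv (hist σ' γ n) (σ' (hist σ' γ n))
    · rw [hdev _ had, hσ]

theorem value_hist_eq {v : List C → ℝ} {σ : List C → C}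
    (hσ : ∀ h, v (h ++ [σ h]) = v h) (γ : List C) {n : ℕ} (hn : γ.length ≤ n) :
    v (hist σ γ n) = v γ := by
  induction n, hn using Nat.le_induction with
  | base => rw [hist_length]
  | succ n hn ih => rw [hist_succ, play_of_le σ γ hn, hσ, ih]

end SeqGame

open SeqGame in
/-- an infinite sequential game with real-valued payoffs, finitely many
choices, whose payoffs are fully determined after `k` moves, has a subgame perfect
equilibrium. -/
theorem stmt2 {A C : Type*} [Nonempty A] [Nonempty C] [Finite C]
    (d : List C → A) (f : A → (ℕ → C) → ℝ)
    (hf01 : ∀ (a : A) (p : ℕ → C), f a p ∈ Set.Icc (0 : ℝ) 1)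
    (k : ℕ)
    (hk : ∀ (a : A) (p q : ℕ → C), (∀ n < k, p n = q n) → f a p = f a q) :
    ∃ σ : List C → C, ∀ (γ : List C) (a : A) (σ' : List C → C),
      Dev d a σ σ' → f a (play σ' γ) ≤ f a (play σ γ) := by
  obtain ⟨c₀⟩ := ‹Nonempty C›
  obtain ⟨best, hbest⟩ := exists_backward_induction_rule c₀ d f
  let σ : List C → C := fun h => best (k - h.length - 1) h
  let v : A → List C → ℝ := fun a h => f a (outcome c₀ best (k - h.length) h)
  have hlong : ∀ a h c, k ≤ h.length → v a (h ++ [c]) = v a h := by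
    intro a h c hh
    simp only [v, List.length_append, List.length_singleton,
      show k - (h.length + 1) = 0 by omega, show k - h.length = 0 by omega]
    exact hk a _ _ fun n hn => List.getD_append _ _ _ _ (by omega)
  have hshort : ∀ a h, h.length < k →
      v a h = f a (outcome c₀ best (k - h.length - 1) (h ++ [σ h])) := by
    intro a h hh
    obtain ⟨m, hm⟩ : ∃ m, k - h.length = m + 1 := ⟨k - h.length - 1, by omega⟩
    simp only [v, σ, hm]
    rfl
  have hstep : ∀ a h c,
      v a (h ++ [c]) = f a (outcome c₀ best (k - h.length - 1) (h ++ [c])) := by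
    intro a h c
    simp only [v, List.length_append, List.length_singleton, Nat.sub_add_eq]
  have hσ : ∀ a h, v a (h ++ [σ h]) = v a h := by
    intro a h
    rcases lt_or_ge h.length k with hh | hh
    · rw [hshort a h hh, hstep]
    · exact hlong a h _ hh
  have hv : ∀ h c, v (d h) (h ++ [c]) ≤ v (d h) h := by
    intro h c
    rw [← hσ (d h) h, hstep, hstep]
    exact hbest _ h c
  have hplay : ∀ a (τ : List C → C) γ n, k ≤ n → v a (hist τ γ n) = f a (play τ γ) := by
    intro a τ γ n hn
    simp only [v, length_hist, Nat.sub_eq_zero_of_le hn]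
    exact hk a _ _ fun i hi => getD_hist τ γ c₀ (by omega)
  refine ⟨σ, fun γ a σ' hdev => ?_⟩
  rw [← hplay a σ' γ (max k γ.length) (le_max_left _ _),
    ← hplay a σ γ (max k γ.length) (le_max_left _ _),
    value_hist_eq (hσ a) γ (le_max_right _ _)]
  exact value_hist_le (hσ a) hv hdev γ (le_max_right _ _)
end

section
/- Let ⟨A, C, d, O, v, (≺_a)_{a∈A}⟩ be an infinite sequential game with C finite, let a ∈ A, and assume: (1) ≺_a is a strict weak order; (2) for every play p ∈ C^ω, every strictly increasing φ : ℕ → ℕ, and every sequence (s_n)_{n∈ℕ} of strategies of a, if g_a(p_{<φ(n+1)}, s_{n+1}) ⊊ g_a(p_{<φ(n)}, s_n) for all n ∈ ℕ, then v(p) ∈ ∩_{n∈ℕ} g_a(p_{<φ(n)}, s_n). Then for every γ ∈ C* there exists a strategy s of a with g_a(γ, s) = G_a(γ). -/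
namespace SeqGame

variable {A C O : Type*}

/-- `r` is a strict weak order: irreflexive, transitive, with transitive incomparability. -/
def SWO (r : O → O → Prop) : Prop :=
  (∀ x, ¬ r x x) ∧ (∀ x y z, r x y → r y z → r x z) ∧
  (∀ x y z, ¬ r x y → ¬ r y z → ¬ r x z)

/-- `r` is a strict linear order: irreflexive, transitive and total. -/
def SLO (r : O → O → Prop) : Prop :=
  (∀ x, ¬ r x x) ∧ (∀ x y z, r x y → r y z → r x z) ∧
  (∀ x y, x = y ∨ r x y ∨ r y x)

/-- The play `p` is consistent with the strategy `s` of player `a` from `γ` on. -/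
def Consistent (d : List C → A) (a : A) (s : List C → C) (γ : List C) (p : ℕ → C) : Prop :=
  pre p γ.length = γ ∧ ∀ n, γ.length ≤ n → d (pre p n) = a → p n = s (pre p n)

/-- The guarantee `g_a(γ, s)` of player `a` (with preference `r`) by strategy `s` at `γ`. -/
def gua (d : List C → A) (v : (ℕ → C) → O) (r : O → O → Prop) (a : A)
    (γ : List C) (s : List C → C) : Set O :=
  {o | ∃ p : ℕ → C, Consistent d a s γ p ∧ ¬ r o (v p)}

/-- The best guarantee `G_a(γ)` of player `a` (with preference `r`) at `γ`. -/
def Gua (d : List C → A) (v : (ℕ → C) → O) (r : O → O → Prop) (a : A) (γ : List C) : Set O :=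
  ⋂ s : List C → C, gua d v r a γ s

/-- `I` is a `r`-terminal interval: `o ∈ I` and `¬(o' ≺ o)` imply `o' ∈ I`. -/
def Terminal (r : O → O → Prop) (I : Set O) : Prop :=
  ∀ o ∈ I, ∀ o', ¬ r o' o → o' ∈ I

/-- `I` is a `r`-extremal interval. -/
def Extremal (r : O → O → Prop) (I : Set O) : Prop :=
  Terminal r I ∨ Terminal (fun x y => r y x) I

/-- `γ C^ω`: the set of plays extending the finite sequence `γ`. -/
def ext (γ : List C) : Set (ℕ → C) := {p | pre p γ.length = γ}

/-- Concatenation `γ·α` of a finite sequence and an infinite one. -/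
def cat (γ : List C) (α : ℕ → C) : ℕ → C :=
  fun n => if h : n < γ.length then γ.get ⟨n, h⟩ else α (n - γ.length)

/-- The two-player win/lose game `⟨C, D, W⟩` is determined. -/
def Determined (D : Set (List C)) (W : Set (ℕ → C)) : Prop :=
  (∃ s : List C → C, ∀ p : ℕ → C, (∀ n, pre p n ∈ D → p n = s (pre p n)) → p ∈ W) ∨
  (∃ t : List C → C, ∀ p : ℕ → C, (∀ n, pre p n ∉ D → p n = t (pre p n)) → p ∉ W)

/-- In a two-player game (`true` is player `a`, `false` is player `b`) with antagonistic
preferences, the preference of each player derived from the preference `r` of player `a`. -/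
def rel (r : O → O → Prop) : Bool → O → O → Prop
  | true => r
  | false => fun o o' => r o' o

end SeqGame

namespace SeqGame

section

variable {A C O : Type*}

theorem length_pre (p : ℕ → C) (n : ℕ) : (pre p n).length = n := by
  simp [pre]

theorem pre_succ (p : ℕ → C) (n : ℕ) : pre p (n + 1) = pre p n ++ [p n] := by
  unfold pre
  rw [List.ofFn_succ_last]
  rfl

theorem take_pre (p : ℕ → C) {n m : ℕ} (h : n ≤ m) : (pre p m).take n = pre p n := by
  induction m, h using Nat.le_induction with
  | base => exact List.take_of_length_le (length_pre p n).le
  | succ m hm ih => rw [pre_succ, List.take_append_of_le_length (by rwa [length_pre]), ih]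

variable {d : List C → A} {v : (ℕ → C) → O} {r : O → O → Prop} {a : A}

theorem Consistent.of_child {s : List C → C} {δ : List C} {c : C} {p : ℕ → C}
    (h : Consistent d a s (δ ++ [c]) p) (hc : d δ = a → c = s δ) : Consistent d a s δ p := by
  obtain ⟨h1, h3⟩ := h
  have hlen : (δ ++ [c]).length = δ.length + 1 := by simp
  rw [hlen] at h1 h3
  rw [pre_succ] at h1
  obtain ⟨h4, h5⟩ := List.append_inj h1 (length_pre p _)
  refine ⟨h4, fun n hn hd => ?_⟩
  rcases hn.eq_or_lt with rfl | hn
  · rw [h4] at hd ⊢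
    rw [← hc hd]
    simpa using h5
  · exact h3 n hn hd

theorem gua_child_subset {s : List C → C} {δ : List C} {c : C} (hc : d δ = a → c = s δ) :
    gua d v r a (δ ++ [c]) s ⊆ gua d v r a δ s := by
  rintro o ⟨p, hp, ho⟩
  exact ⟨p, hp.of_child hc, ho⟩

theorem Gua_child_subset {δ : List C} (hδ : d δ ≠ a) (c : C) :
    Gua d v r a (δ ++ [c]) ⊆ Gua d v r a δ :=
  Set.iInter_mono fun _ => gua_child_subset fun h => absurd h hδ

theorem terminal_gua (hswo : SWO r) (γ : List C) (s : List C → C) :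
    Terminal r (gua d v r a γ s) := by
  rintro o ⟨p, hp, ho⟩ o' ho'
  exact ⟨p, hp, hswo.2.2 _ _ _ ho' ho⟩

theorem terminal_Gua (hswo : SWO r) (γ : List C) : Terminal r (Gua d v r a γ) := by
  intro o ho o' ho'
  exact Set.mem_iInter.2 fun s => terminal_gua hswo γ s o (Set.mem_iInter.1 ho s) o' ho'

theorem Terminal.ssubset (hswo : SWO r) {I J : Set O} (hI : Terminal r I) (hJ : Terminal r J)
    {o : O} (hoI : o ∈ I) (hoJ : o ∉ J) : J ⊂ I := by
  refine ⟨fun x hx => ?_, fun h => hoJ (h hoI)⟩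
  have hox : r o x := by
    by_contra h
    exact hoJ (hJ x hx o h)
  exact hI o hoI x fun h => hswo.1 _ (hswo.2.1 _ _ _ hox h)

theorem exists_forall_not_rel [Nonempty C] [Finite C] (hswo : SWO r) (f : C → O) :
    ∃ c₀, ∀ c, ¬ r (f c₀) (f c) := by
  let q : C → C → Prop := fun x y => r (f y) (f x)
  have : IsTrans C q := ⟨fun _ _ _ h h' => hswo.2.1 _ _ _ h' h⟩
  have : Std.Irrefl q := ⟨fun _ => hswo.1 _⟩
  obtain ⟨c₀, -, h⟩ := (Finite.wellFounded_of_trans_of_irrefl q).has_min Set.univ Set.univ_nonempty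
  exact ⟨c₀, fun c => h c (Set.mem_univ c)⟩

/-- Some choice preserves an upper bound on the best guarantee. -/
theorem exists_child_Gua_subset [Nonempty C] [Finite C] (hswo : SWO r) {δ : List C}
    {I : Set O} (hI : Gua d v r a δ ⊆ I) : ∃ c, Gua d v r a (δ ++ [c]) ⊆ I := by
  by_contra! h
  choose f hf hfI using fun c => Set.not_subset.1 (h c)
  obtain ⟨c₀, hc₀⟩ := exists_forall_not_rel hswo f
  refine hfI c₀ (hI (Set.mem_iInter.2 fun s => gua_child_subset (fun _ => rfl) ?_))
  exact Set.mem_iInter.1 (terminal_Gua hswo _ _ (hf (s δ)) _ (hc₀ _)) s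

/-- If the best guarantee stays below `I` along a play while no strategy guarantees `I`, then the
hypothesis on decreasing chains of guarantees puts the outcome of the play in `I`. -/
theorem outcome_mem_of_forall_not_gua_subset (hswo : SWO r)
    (hchain : ∀ (p : ℕ → C) (φ : ℕ → ℕ), StrictMono φ → ∀ s : ℕ → List C → C,
      (∀ n, gua d v r a (pre p (φ (n + 1))) (s (n + 1)) ⊂ gua d v r a (pre p (φ n)) (s n)) →
      v p ∈ ⋂ n, gua d v r a (pre p (φ n)) (s n))
    {p : ℕ → C} {k : ℕ} {I : Set O} (hG : ∀ n, k ≤ n → Gua d v r a (pre p n) ⊆ I)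
    (hI : ∀ n, k ≤ n → ∀ s, ¬ gua d v r a (pre p n) s ⊆ I) : v p ∈ I := by
  by_contra hv
  have avoid : ∀ o, o ∉ I → ∀ n, k ≤ n → ∃ s, o ∉ gua d v r a (pre p n) s := by
    intro o ho n hn
    by_contra! h
    exact ho (hG n hn (Set.mem_iInter.2 h))
  have step : ∀ n s, ∃ s', gua d v r a (pre p (k + (n + 1))) s' ⊂ gua d v r a (pre p (k + n)) s := by
    intro n s
    obtain ⟨o, ho, hoI⟩ := Set.not_subset.1 (hI (k + n) (by omega) s)
    obtain ⟨s', hs'⟩ := avoid o hoI (k + (n + 1)) (by omega)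
    exact ⟨s', (terminal_gua hswo _ _).ssubset hswo (terminal_gua hswo _ _) ho hs'⟩
  obtain ⟨s₀, hs₀⟩ := avoid _ hv k le_rfl
  choose next hnext using step
  let s : ℕ → List C → C := fun n => Nat.rec s₀ (fun n t => next n t) n
  have := hchain p (fun n => k + n) (fun _ _ h => Nat.add_lt_add_left h k) s
    fun n => hnext n (s n)
  exact hs₀ (Set.mem_iInter.1 this 0)

open Classical in
/-- The strategy that plays `t` until a prefix of length at least `k` satisfying `P` has been
reached, and plays `w δ` from the first such prefix `δ` on. -/
noncomputable def switch (P : List C → Prop) (k : ℕ) (w : List C → List C → C) (t : List C → C) :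
    List C → C := fun h =>
  if H : ∃ n, k ≤ n ∧ n ≤ h.length ∧ P (h.take n) then w (h.take (Nat.find H)) h else t h

theorem switch_of_forall_not {P : List C → Prop} {k : ℕ} {w : List C → List C → C}
    {t : List C → C} {p : ℕ → C} {m : ℕ} (h : ∀ n, k ≤ n → n ≤ m → ¬ P (pre p n)) :
    switch P k w t (pre p m) = t (pre p m) := by
  unfold switch
  refine dif_neg ?_
  rintro ⟨n, hn, hm, hP⟩
  rw [length_pre] at hm
  rw [take_pre p hm] at hP
  exact h n hn hm hP

theorem switch_of_first {P : List C → Prop} {k : ℕ} {w : List C → List C → C}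
    {t : List C → C} {p : ℕ → C} {N m : ℕ} (hkN : k ≤ N) (hNm : N ≤ m) (hP : P (pre p N))
    (h : ∀ n, k ≤ n → n < N → ¬ P (pre p n)) :
    switch P k w t (pre p m) = w (pre p N) (pre p m) := by
  classical
  have H : ∃ n, k ≤ n ∧ n ≤ (pre p m).length ∧ P ((pre p m).take n) :=
    ⟨N, hkN, by rwa [length_pre], by rwa [take_pre p hNm]⟩
  have hfind : Nat.find H = N := by
    rw [Nat.find_eq_iff]
    refine ⟨⟨hkN, by rwa [length_pre], by rwa [take_pre p hNm]⟩, ?_⟩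
    rintro n hn ⟨h1, -, h3⟩
    rw [take_pre p (hn.le.trans hNm)] at h3
    exact h n h1 hn h3
  unfold switch
  rw [dif_pos H]
  convert rfl using 2
  rw [← take_pre p hNm, ← hfind]

end

end SeqGame

open SeqGame in
/-- in an infinite sequential game with finitely many choices, if strictly
decreasing chains of guarantees along a play capture the outcome of that play, then the
best guarantee of player `a` is witnessed by some strategy at every position. -/
theorem stmt6 {A C O : Type*} [Nonempty A] [Nonempty C] [Finite C] [Nonempty O]
    (d : List C → A) (v : (ℕ → C) → O) (r : O → O → Prop) (a : A)
    (hswo : SWO r)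
    (h2 : ∀ (p : ℕ → C) (φ : ℕ → ℕ), StrictMono φ → ∀ s : ℕ → List C → C,
      (∀ n, gua d v r a (pre p (φ (n + 1))) (s (n + 1)) ⊂ gua d v r a (pre p (φ n)) (s n)) →
      v p ∈ ⋂ n, gua d v r a (pre p (φ n)) (s n)) :
    ∀ γ : List C, ∃ s : List C → C, gua d v r a γ s = Gua d v r a γ := by
  classical
  intro γ
  set I := Gua d v r a γ
  let P : List C → Prop := fun δ => ∃ s, gua d v r a δ s ⊆ I
  have hw : ∀ δ, ∃ s, P δ → gua d v r a δ s ⊆ I := by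
    intro δ
    by_cases h : P δ
    · exact h.imp fun _ hs _ => hs
    · exact ⟨fun _ => Classical.arbitrary C, fun h' => absurd h' h⟩
  choose w hw using hw
  have ht : ∀ δ, ∃ c, Gua d v r a δ ⊆ I → Gua d v r a (δ ++ [c]) ⊆ I := by
    intro δ
    by_cases h : Gua d v r a δ ⊆ I
    · exact (exists_child_Gua_subset hswo h).imp fun _ hc _ => hc
    · exact ⟨Classical.arbitrary C, fun h' => absurd h' h⟩
  choose t ht using ht
  refine ⟨switch P γ.length w t, Set.Subset.antisymm ?_ (Set.iInter_subset _ _)⟩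
  rintro o ⟨p, ⟨hpγ, hp⟩, ho⟩
  refine terminal_Gua hswo γ (v p) ?_ o ho
  by_cases hex : ∃ n, γ.length ≤ n ∧ P (pre p n)
  · obtain ⟨hk, hP⟩ := Nat.find_spec hex
    have hmin : ∀ n, γ.length ≤ n → n < Nat.find hex → ¬ P (pre p n) :=
      fun n hn hlt h => Nat.find_min hex hlt ⟨hn, h⟩
    refine hw _ hP ⟨p, ⟨by rw [length_pre], fun n hn hd => ?_⟩, hswo.1 _⟩
    rw [length_pre] at hn
    rw [hp n (hk.trans hn) hd, switch_of_first hk hn hP hmin]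
  · push Not at hex
    refine outcome_mem_of_forall_not_gua_subset hswo h2 (k := γ.length) (fun n hn => ?_)
      fun n hn s hs => hex n hn ⟨s, hs⟩
    induction n, hn using Nat.le_induction with
    | base => rw [hpγ]
    | succ n hn ih =>
      rw [pre_succ]
      by_cases hd : d (pre p n) = a
      · rw [hp n hn hd, switch_of_forall_not fun m hm _ => hex m hm]
        exact ht _ ih
      · exact (Gua_child_subset hd _).trans ih
end
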